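/- arXiv:2604.13799 — 2 statements merged into one kernel-verified Lean document; each statement's English description precedes it below -/
import Mathlib

section
/- Let A be the image of a continuous injective map from the closed unit interval [0,1] into the 2-sphere S² (i.e., A is an embedded arc in S²). Then the complement S² \ A is a connected set. (This is the fact, used in the paper's Step 2 of the construction of standard meander diagrams, that 'embedded arcs do not separate S²'.) -/
open Set Topology

/-- Every continuous nowhere vanishing function on a simply connected, locally path connected space
has a continuous logarithm. -/
theorem exists_continuous_exp_eq {X : Type*} [TopologicalSpace X] [LocallyPathConnectedSpace X]
    [SimplyConnectedSpace X] {g : X → ℂ} (hg : Continuous g) (h0 : ∀ x, g x ≠ 0) :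
    ∃ k : X → ℂ, Continuous k ∧ ∀ x, Complex.exp (k x) = g x := by
  obtain ⟨x₀⟩ : Nonempty X := inferInstance
  obtain ⟨k, ⟨-, hk⟩, -⟩ := Complex.isCoveringMapOn_exp.existsUnique_continuousMap_lifts
    ⟨g, hg⟩ (Complex.exp_log (h0 x₀)) h0
  exact ⟨k, k.continuous, congrFun hk⟩

/-- There is no continuous logarithm of `z - p` on a circle of positive radius around `p`. -/
theorem not_exp_eq_sub_on_circle {k : ℂ → ℂ} (hk : Continuous k) (p : ℂ) {R : ℝ} (hR : 0 < R)
    (h : ∀ z, ‖z - p‖ = R → Complex.exp (k z) = z - p) : False := by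
  let c : ℝ → ℂ := fun θ ↦ p + R * Complex.exp (θ * Complex.I)
  have hc : ∀ θ, Complex.exp (k (c θ)) = R * Complex.exp (θ * Complex.I) := fun θ ↦ by
    have : ‖c θ - p‖ = R := by
      simp [c, Complex.norm_exp_ofReal_mul_I, abs_of_pos hR]
    simpa [c] using h _ this
  have key : (fun θ ↦ k (c θ)) = fun θ : ℝ ↦ k (c 0) + θ * Complex.I := by
    refine Complex.isCoveringMap_exp.eq_of_comp_eq (by fun_prop) (by fun_prop) ?_ 0 (by simp)
    ext θ
    simp [hc, Complex.exp_add]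
  have h2 : k (c (2 * Real.pi)) = k (c 0) := by
    simp [c, Complex.exp_two_pi_mul_I]
  have := congrFun key (2 * Real.pi)
  simp [h2, Real.pi_ne_zero] at this

/-- An arc in the plane has no complementary region whose union with the arc is compact. -/
theorem eq_empty_of_isCompact_union_range_arc {γ : Icc (0 : ℝ) 1 → ℂ} (hγ : Continuous γ)
    (hinj : Function.Injective γ) {D : Set ℂ} (hD : IsOpen D) (hdisj : Disjoint D (range γ))
    (hK : IsCompact (D ∪ range γ)) : D = ∅ := by
  by_contra hne
  obtain ⟨p, hp⟩ := nonempty_iff_ne_empty.mpr hne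
  have hpγ : ∀ t, γ t ≠ p := fun t ht ↦ disjoint_left.mp hdisj hp ⟨t, ht⟩
  obtain ⟨l, hl, hlexp⟩ := exists_continuous_exp_eq
    (g := fun s : ℝ ↦ γ (projIcc 0 1 zero_le_one s) - p)
    ((hγ.comp continuous_projIcc).sub continuous_const) (fun s ↦ sub_ne_zero.mpr (hpγ _))
  obtain ⟨G, hG⟩ := ContinuousMap.exists_extension' (hγ.isClosedEmbedding hinj)
    (⟨fun t ↦ l t, by fun_prop⟩ : C(Icc (0 : ℝ) 1, ℂ))
  have hGγ : ∀ z ∈ range γ, Complex.exp (G z) = z - p := by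
    rintro _ ⟨t, rfl⟩
    have := congrFun hG t
    simp only [Function.comp_apply, ContinuousMap.coe_mk] at this
    rw [this, hlexp, projIcc_val]
  classical
  let h : ℂ → ℂ := D.piecewise (fun z ↦ Complex.exp (G z)) (fun z ↦ z - p)
  have hfr : frontier D ⊆ range γ := by
    intro z hz
    have h1 : z ∈ D ∪ range γ :=
      closure_minimal subset_union_left hK.isClosed (frontier_subset_closure hz)
    rw [hD.frontier_eq] at hz
    exact h1.resolve_left hz.2
  have hcont : Continuous h := by
    refine continuous_piecewise (fun z hz ↦ hGγ z (hfr hz)) ?_ ?_ <;> fun_prop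
  have h0 : ∀ z, h z ≠ 0 := by
    intro z
    by_cases hz : z ∈ D
    · simp [h, hz]
    · simpa [h, hz, sub_eq_zero] using fun e : z = p ↦ hz (e ▸ hp)
  obtain ⟨k, hk, hkh⟩ := exists_continuous_exp_eq hcont h0
  obtain ⟨R, hR, hDR⟩ := hK.isBounded.subset_ball_lt 0 p
  refine not_exp_eq_sub_on_circle hk p hR fun z hz ↦ ?_
  have hzD : z ∉ D := fun hzD ↦ by
    have := hDR (Or.inl hzD)
    rw [mem_ball_iff_norm, hz] at this
    exact lt_irrefl _ this
  rw [hkh]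
  simp [h, hzD]

/-- The 2-sphere punctured at a point is homeomorphic to the plane. -/
theorem exists_isOpenEmbedding_range_eq_compl_singleton
    (q : Metric.sphere (0 : EuclideanSpace ℝ (Fin 3)) 1) :
    ∃ φ : ℂ → Metric.sphere (0 : EuclideanSpace ℝ (Fin 3)) 1,
      IsOpenEmbedding φ ∧ range φ = {q}ᶜ := by
  have : Fact (Module.finrank ℝ (EuclideanSpace ℝ (Fin 3)) = 2 + 1) := ⟨by simp⟩
  let e := Complex.orthonormalBasisOneI.repr.toHomeomorph
  let s := (stereographic' 2 q).symm
  have hs : s.source = univ := stereographic'_target q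
  refine ⟨s ∘ e, (s.isOpenEmbedding hs).comp e.isOpenEmbedding, ?_⟩
  rw [e.surjective.range_comp, ← image_univ, ← hs, s.image_source_eq_target]
  exact stereographic'_source q

/-- No arc fills the 2-sphere. -/
theorem arc_compl_nonempty
    {f : Icc (0 : ℝ) 1 → Metric.sphere (0 : EuclideanSpace ℝ (Fin 3)) 1}
    (hf : Continuous f) (hinj : Function.Injective f) : (range f)ᶜ.Nonempty := by
  by_contra hne
  rw [not_nonempty_iff_eq_empty, compl_empty_iff] at hne
  let m : Icc (0 : ℝ) 1 := ⟨1 / 2, by norm_num, by norm_num⟩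
  obtain ⟨φ, hφ, hr⟩ := exists_isOpenEmbedding_range_eq_compl_singleton (f m)
  have h1 : IsPreconnected ({f m}ᶜ : Set (Metric.sphere (0 : EuclideanSpace ℝ (Fin 3)) 1)) :=
    hr ▸ isPreconnected_range hφ.continuous
  have h2 : IsPreconnected ({m}ᶜ : Set (Icc (0 : ℝ) 1)) := by
    have := h1.preimage_of_isClosedMap hinj (hf.isClosedEmbedding hinj).isClosedMap
      (by simp [hne])
    rwa [← image_singleton, preimage_compl, hinj.preimage_image] at this
  have h3 := h2.Icc_subset (a := 0) (b := 1)
    (by simp [m, Subtype.ext_iff]) (by simp [m, Subtype.ext_iff])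
  exact h3 (a := m) ⟨m.2.1, m.2.2⟩ rfl

/-- An embedded arc (the image of a continuous injective map from `[0,1]`)
in the 2-sphere `S²` does not separate `S²`: its complement is connected. -/
theorem arc_complement_connected
    (f : Set.Icc (0:ℝ) 1 → Metric.sphere (0 : EuclideanSpace ℝ (Fin 3)) 1)
    (hf_cont : Continuous f) (hf_inj : Function.Injective f)
    (A : Set (Metric.sphere (0 : EuclideanSpace ℝ (Fin 3)) 1))
    (hA : A = Set.range f) :
    IsConnected Aᶜ := by
  subst hA
  refine ⟨arc_compl_nonempty hf_cont hf_inj, ?_⟩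
  rintro U V hU hV hUV ⟨p, hpA, hpU⟩ ⟨q, hqA, hqV⟩
  by_contra hemp
  rw [not_nonempty_iff_eq_empty] at hemp
  have hsplit : ∀ x, x ∉ range f → x ∈ U → x ∉ V := fun x hx hxU hxV ↦
    notMem_empty x (hemp ▸ ⟨hx, hxU, hxV⟩)
  have hclosed : IsClosed (range f) := (isCompact_range hf_cont).isClosed
  obtain ⟨φ, hφ, hr⟩ := exists_isOpenEmbedding_range_eq_compl_singleton q
  have hmem : ∀ x, x ≠ q → ∃ z, φ z = x := fun x hx ↦ by
    have : x ∈ range φ := by rw [hr]; exact hx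
    exact this
  choose γ hγ using fun t ↦ hmem (f t) (fun e ↦ hqA ⟨t, e⟩)
  have hφγ : φ ∘ γ = f := funext hγ
  have hrange : range γ = φ ⁻¹' range f := by
    rw [← hφγ, range_comp, hφ.injective.preimage_image]
  have hK : IsClosed (U ∩ (range f)ᶜ ∪ range f) := by
    have : U ∩ (range f)ᶜ ∪ range f = (V ∩ (range f)ᶜ)ᶜ := by
      ext x
      have h1 := hsplit x
      have h2 := @hUV x
      simp only [mem_union, mem_inter_iff, mem_compl_iff] at h2 ⊢
      tauto
    rw [this]
    exact (hV.inter hclosed.isOpen_compl).isClosed_compl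
  have hD := eq_empty_of_isCompact_union_range_arc (γ := γ) (D := φ ⁻¹' (U ∩ (range f)ᶜ))
    (hφ.isEmbedding.continuous_iff.mpr (hφγ ▸ hf_cont))
    (Function.Injective.of_comp (f := φ) (hφγ ▸ hf_inj))
    ((hU.inter hclosed.isOpen_compl).preimage hφ.continuous)
    (by
      rw [hrange]
      exact (disjoint_compl_left.mono_left inter_subset_right).preimage φ)
    (by
      rw [hrange, ← preimage_union, hφ.isInducing.isCompact_preimage_iff]
      · exact hK.isCompact
      · rw [hr]
        rintro x (hx | hx) rfl
        · exact hsplit x hx.2 hx.1 hqV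
        · exact hqA hx)
  obtain ⟨z, rfl⟩ := hmem p (fun e ↦ hsplit p hpA hpU (e ▸ hqV))
  exact notMem_empty z (hD ▸ (⟨hpU, hpA⟩ : z ∈ φ ⁻¹' (U ∩ (range f)ᶜ)))
end

section
/- Let A be the image of a continuous injective map from the closed unit interval [0,1] into the 2-sphere S² (i.e., A is an embedded arc in S²). Then the complement S² \ A is path-connected. -/
open Set Topology Metric

/-- The identity of a circle of radius `R > 0`, translated to the origin, has no continuous
logarithm. -/
theorem not_exists_continuous_log_circle {R : ℝ} (hR : 0 < R) (a : ℂ) {h : ℂ → ℂ}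
    (hc : Continuous h) :
    ¬ ∀ z ∈ sphere a R, Complex.exp (h z) = z - a := by
  intro hexp
  let c : ℝ → ℂ := fun t ↦ h (a + R * Complex.exp (t * Complex.I)) - t * Complex.I
  have hcc : Continuous c := by fun_prop
  have hval (t : ℝ) : Complex.exp (c t) = R := by
    have hmem : a + R * Complex.exp (t * Complex.I) ∈ sphere a R := by
      simp [Complex.norm_exp_ofReal_mul_I, abs_of_pos hR]
    rw [Complex.exp_sub, hexp _ hmem, add_sub_cancel_left,
      mul_div_assoc, div_self (Complex.exp_ne_zero _), mul_one]
  have hconst : c 0 = c (2 * Real.pi) :=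
    Complex.isCoveringMap_exp.const_of_comp hcc
      (fun s t ↦ Subtype.ext ((hval s).trans (hval t).symm)) _ _
  simp only [c, Complex.ofReal_zero, zero_mul, Complex.exp_zero, Complex.ofReal_mul,
    Complex.ofReal_ofNat, Complex.exp_two_pi_mul_I, sub_zero] at hconst
  exact Complex.two_pi_I_ne_zero (sub_eq_self.mp hconst.symm)

/-- **Borsuk's separation criterion**, for simply connected sets: if two disjoint open sets have
as union the complement of a closed embedded copy of a simply connected, locally path-connected
space in the plane, and one of them has bounded complement, then the other one is empty. -/
theorem eq_empty_of_union_eq_compl_range {X : Type*} [TopologicalSpace X]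
    [SimplyConnectedSpace X] [LocallyPathConnectedSpace X] {e : X → ℂ} (he : IsClosedEmbedding e)
    {U V : Set ℂ} (hU : IsOpen U) (hV : IsOpen V) (hdisj : Disjoint U V)
    (hcover : U ∪ V = (range e)ᶜ) (hbdd : Bornology.IsBounded Vᶜ) : U = ∅ := by
  classical
  by_contra hne
  obtain ⟨a, ha⟩ := nonempty_iff_ne_empty.mpr hne
  have hea (x : X) : e x - a ≠ 0 := by
    intro h
    have : a ∈ (range e)ᶜ := hcover ▸ Or.inl ha
    exact this ⟨x, sub_eq_zero.mp h⟩
  obtain ⟨x₀⟩ : Nonempty X := inferInstance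
  obtain ⟨g, ⟨-, hg⟩, -⟩ := Complex.isCoveringMapOn_exp.existsUnique_continuousMap_lifts
    (⟨fun x ↦ e x - a, he.continuous.sub continuous_const⟩ : C(X, ℂ))
    (Complex.exp_log (hea x₀)) hea
  obtain ⟨G, hG⟩ := g.exists_extension' he
  have hGe (x : X) : Complex.exp (G (e x)) = e x - a := by
    have h₁ : G (e x) = g x := congrFun hG x
    have h₂ : Complex.exp (g x) = e x - a := congrFun hg x
    rw [h₁, h₂]
  let F : ℂ → ℂ := V.piecewise (fun z ↦ z - a) (fun z ↦ Complex.exp (G z))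
  have hF : Continuous F := by
    refine Continuous.piecewise (fun z hz ↦ ?_) (by fun_prop) (by fun_prop)
    have hzV : z ∉ V := fun h ↦ hz.2 (hV.interior_eq.symm ▸ h)
    have hzU : z ∉ U := fun h ↦ (hdisj.closure_right hU).notMem_of_mem_left h hz.1
    have hzr : z ∈ range e := by
      by_contra h
      exact (hcover.symm ▸ h : z ∈ U ∪ V).elim hzU hzV
    obtain ⟨x, rfl⟩ := hzr
    exact (hGe x).symm
  have hF0 (z : ℂ) : F z ≠ 0 := by
    by_cases hz : z ∈ V
    · simp only [F, piecewise_eq_of_mem _ _ _ hz]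
      exact sub_ne_zero.mpr fun h ↦ hdisj.notMem_of_mem_left ha (h ▸ hz)
    · simp only [F, piecewise_eq_of_notMem _ _ _ hz]
      exact Complex.exp_ne_zero _
  obtain ⟨h, ⟨-, hh⟩, -⟩ := Complex.isCoveringMapOn_exp.existsUnique_continuousMap_lifts
    (⟨F, hF⟩ : C(ℂ, ℂ)) (Complex.exp_log (hF0 0)) hF0
  obtain ⟨R, hR, hVR⟩ := hbdd.subset_ball_lt 0 a
  refine not_exists_continuous_log_circle hR a h.continuous fun z hz ↦ ?_
  have hzV : z ∈ V := by
    by_contra hzV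
    exact (mem_ball.mp (hVR hzV)).ne (mem_sphere.mp hz)
  have hFz : F z = z - a := piecewise_eq_of_mem _ _ _ hzV
  exact (congrFun hh z).trans hFz

/-- The sphere minus a point is the image of an open embedding of the complex plane. -/
theorem exists_isOpenEmbedding_complex_range_eq_compl
    (q : sphere (0 : EuclideanSpace ℝ (Fin 3)) 1) :
    ∃ φ : ℂ → sphere (0 : EuclideanSpace ℝ (Fin 3)) 1, IsOpenEmbedding φ ∧ range φ = {q}ᶜ := by
  have : Fact (Module.finrank ℝ (EuclideanSpace ℝ (Fin 3)) = 2 + 1) := ⟨by simp⟩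
  let s := stereographic' 2 q
  have hs : IsOpenEmbedding s.symm := s.symm.isOpenEmbedding (by simp [s])
  let L := Complex.orthonormalBasisOneI.repr.toHomeomorph
  refine ⟨s.symm ∘ L, hs.comp L.isOpenEmbedding, ?_⟩
  rw [L.surjective.range_comp, ← image_univ, ← stereographic'_target q,
    s.symm_image_target_eq_source, stereographic'_source]

/-- An arc in the sphere is not the whole sphere. -/
theorem not_surjective_of_injective_unitInterval_sphere
    {f : Icc (0 : ℝ) 1 → sphere (0 : EuclideanSpace ℝ (Fin 3)) 1}
    (hf : Continuous f) (hinj : Function.Injective f) : ¬ Function.Surjective f := by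
  intro hsurj
  let F := (hf.isClosedEmbedding hinj).isEmbedding.toHomeomorphOfSurjective hsurj
  let m : Icc (0 : ℝ) 1 := ⟨1 / 2, by norm_num, by norm_num⟩
  obtain ⟨φ, hφ, hrange⟩ := exists_isOpenEmbedding_complex_range_eq_compl (F m)
  have hpre : IsPreconnected ({m}ᶜ : Set (Icc (0 : ℝ) 1)) := by
    have h := (hrange ▸ isPreconnected_range hφ.continuous :
      IsPreconnected ({F m}ᶜ : Set (sphere (0 : EuclideanSpace ℝ (Fin 3)) 1)))
    have := F.isPreconnected_preimage.mpr h
    rwa [preimage_compl, ← image_singleton, F.preimage_image] at this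
  have h0 : (0 : Icc (0 : ℝ) 1) ∈ ({m}ᶜ : Set _) := fun h ↦ by
    have := congrArg Subtype.val h
    norm_num [m] at this
  have h1 : (1 : Icc (0 : ℝ) 1) ∈ ({m}ᶜ : Set _) := fun h ↦ by
    have := congrArg Subtype.val h
    norm_num [m] at this
  exact hpre.ordConnected.out h0 h1 ⟨m.2.1, m.2.2⟩ rfl

/-- If two disjoint open subsets of the sphere have as union the complement of an arc, then one of
them is empty. -/
theorem eq_empty_or_eq_empty_of_union_eq_compl_range_sphere
    {f : Icc (0 : ℝ) 1 → sphere (0 : EuclideanSpace ℝ (Fin 3)) 1}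
    (hf : Continuous f) (hinj : Function.Injective f)
    {U V : Set (sphere (0 : EuclideanSpace ℝ (Fin 3)) 1)}
    (hU : IsOpen U) (hV : IsOpen V) (hdisj : Disjoint U V) (hcover : U ∪ V = (range f)ᶜ) :
    U = ∅ ∨ V = ∅ := by
  refine or_iff_not_imp_right.mpr fun hVne ↦ ?_
  obtain ⟨q, hq⟩ := nonempty_iff_ne_empty.mpr hVne
  obtain ⟨φ, hφ, hrange⟩ := exists_isOpenEmbedding_complex_range_eq_compl q
  have hqf : q ∈ (range f)ᶜ := hcover ▸ Or.inr hq
  have hlift (t : Icc (0 : ℝ) 1) : ∃ z, φ z = f t := by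
    have : f t ∈ ({q}ᶜ : Set _) := fun h ↦ hqf ⟨t, h⟩
    rwa [← hrange] at this
  choose e he using hlift
  have hφe : φ ∘ e = f := funext he
  have hec : Continuous e := hφ.isInducing.continuous_iff.mpr (hφe ▸ hf)
  have hei : Function.Injective e := Function.Injective.of_comp (f := φ) (hφe ▸ hinj)
  have : ContractibleSpace (Icc (0 : ℝ) 1) :=
    (convex_Icc (0 : ℝ) 1).contractibleSpace ⟨0, by simp⟩
  have : LocallyPathConnectedSpace (Icc (0 : ℝ) 1) :=
    (convex_Icc (0 : ℝ) 1).locallyPathConnectedSpace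
  have hpre : φ ⁻¹' range f = range e := by
    rw [← hφe, range_comp, hφ.injective.preimage_image]
  have hbdd : Bornology.IsBounded (φ ⁻¹' V)ᶜ := by
    refine (hφ.isInducing.isCompact_preimage' hV.isClosed_compl.isCompact ?_).isBounded
    rw [hrange]
    exact compl_subset_compl.mpr (singleton_subset_iff.mpr hq)
  have hempty := eq_empty_of_union_eq_compl_range (hec.isClosedEmbedding hei)
    (hU.preimage hφ.continuous) (hV.preimage hφ.continuous) (hdisj.preimage φ)
    (by rw [← preimage_union, hcover, preimage_compl, hpre]) hbdd
  refine eq_empty_of_forall_notMem fun p hp ↦ ?_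
  have hpq : p ∈ range φ := by
    rw [hrange]
    exact fun h ↦ hdisj.notMem_of_mem_left hp (mem_singleton_iff.mp h ▸ hq)
  obtain ⟨z, rfl⟩ := hpq
  exact (hempty ▸ hp : z ∈ (∅ : Set ℂ))

/-- The complement of an embedded arc (the image of a continuous injective map
from `[0,1]`) in the 2-sphere `S²` is path-connected. -/
theorem arc_complement_pathConnected
    (f : Set.Icc (0:ℝ) 1 → Metric.sphere (0 : EuclideanSpace ℝ (Fin 3)) 1)
    (hf_cont : Continuous f) (hf_inj : Function.Injective f)
    (A : Set (Metric.sphere (0 : EuclideanSpace ℝ (Fin 3)) 1))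
    (hA : A = Set.range f) :
    IsPathConnected Aᶜ := by
  subst hA
  have : Fact (Module.finrank ℝ (EuclideanSpace ℝ (Fin 3)) = 2 + 1) := ⟨by simp⟩
  have : LocallyPathConnectedSpace (Metric.sphere (0 : EuclideanSpace ℝ (Fin 3)) 1) :=
    ChartedSpace.locallyPathConnectedSpace (EuclideanSpace ℝ (Fin 2)) _
  have hopen : IsOpen (range f)ᶜ := (isCompact_range hf_cont).isClosed.isOpen_compl
  refine hopen.isConnected_iff_isPathConnected.mp ⟨?_, ?_⟩
  · rw [nonempty_compl, Ne, range_eq_univ]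
    exact not_surjective_of_injective_unitInterval_sphere hf_cont hf_inj
  · rw [isPreconnected_iff_subset_of_disjoint]
    intro U V hU hV hsub hdisj
    have h := eq_empty_or_eq_empty_of_union_eq_compl_range_sphere hf_cont hf_inj
      (hopen.inter hU) (hopen.inter hV)
      (disjoint_iff_inter_eq_empty.mpr (by rw [← inter_inter_distrib_left, hdisj]))
      (by rw [← inter_union_distrib_left, inter_eq_left.mpr hsub])
    rcases h with h | h
    · exact Or.inr fun x hx ↦ (hsub hx).resolve_left fun hxU ↦ (h ▸ ⟨hx, hxU⟩ : x ∈ (∅ : Set _))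
    · exact Or.inl fun x hx ↦ (hsub hx).resolve_right fun hxV ↦ (h ▸ ⟨hx, hxV⟩ : x ∈ (∅ : Set _))
end
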